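/- For c > 0 and σ > 0, the ergodic capacity of the double-Rayleigh fading channel, C = ∫_0^∞ ln(1+a)·(1/(cσ²))·K₀(√(2a/(cσ²))) da (with bandwidth B = 1), equals (1/(2cσ²))·G^{3,1}_{1,3}(1/(2cσ²) | −1; −1, −1, 0), where G denotes the Meijer G-function. -/

import Mathlib

open MeasureTheory Real Complex

/-- Modified Bessel function of the second kind of order zero,
`K₀(z) = ∫_0^∞ e^{−z cosh t} dt`. -/
noncomputable def besselK0 (z : ℝ) : ℝ := ∫ t in Set.Ioi (0 : ℝ), Real.exp (-z * Real.cosh t)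

/-- The Meijer G-function `G^{3,1}_{1,3}(z | −1; −1, −1, 0)`, via its Mellin–Barnes
contour integral along the vertical line `Re s = 3/2` (with `ds = i dt`):
`(1/(2πi)) ∫ Γ(−1+s)Γ(−1+s)Γ(s)Γ(2−s) z^{−s} ds`. -/
noncomputable def meijerG3113 (z : ℝ) : ℂ :=
  (1 / (2 * (Real.pi : ℂ) * Complex.I)) *
    ∫ t : ℝ,
      (Complex.Gamma (-1 + ((3 : ℂ) / 2 + t * Complex.I)) *
          Complex.Gamma (-1 + ((3 : ℂ) / 2 + t * Complex.I)) *
          Complex.Gamma ((3 : ℂ) / 2 + t * Complex.I) *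
          Complex.Gamma (2 - ((3 : ℂ) / 2 + t * Complex.I))) *
        (z : ℂ) ^ (-((3 : ℂ) / 2 + t * Complex.I)) * Complex.I

theorem HasMellin.congr_Ioi {f g : ℝ → ℂ} {s m : ℂ} (hf : HasMellin f s m)
    (h : ∀ x, 0 < x → f x = g x) : HasMellin g s m := by
  have h' : Set.EqOn (fun t : ℝ => (t : ℂ) ^ (s - 1) • f t)
      (fun t : ℝ => (t : ℂ) ^ (s - 1) • g t) (Set.Ioi 0) := fun t ht => by
    simp only [h t ht]
  refine ⟨hf.1.congr_fun h' measurableSet_Ioi, ?_⟩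
  rw [← hf.2]
  exact (setIntegral_congr_fun measurableSet_Ioi h').symm

/-- The Mellin transform of a multiplicative convolution is the product of Mellin transforms. -/
theorem HasMellin.mulConvolution {f g : ℝ → ℂ} (hf : Measurable f) (hg : Measurable g)
    {s m n : ℂ} (hfs : HasMellin f s m) (hgs : HasMellin g (1 - s) n) :
    HasMellin (fun x => ∫ t in Set.Ioi (0 : ℝ), f (x * t) * g t) s (m * n) := by
  let H : ℝ → ℝ → ℂ := fun x t => (x : ℂ) ^ (s - 1) * (f (x * t) * g t)
  have hmeas : Measurable (Function.uncurry H) := by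
    unfold H Function.uncurry
    fun_prop
  have hscale : ∀ x t : ℝ, 0 < x → 0 < t → (x : ℂ) ^ (s - 1) * f (x * t) =
      (t : ℂ) ^ (1 - s) * (((x * t : ℝ) : ℂ) ^ (s - 1) * f (x * t)) := by
    intro x t hx ht
    have ht' : (t : ℂ) ≠ 0 := by exact_mod_cast ht.ne'
    have : (t : ℂ) ^ (1 - s) * (t : ℂ) ^ (s - 1) = 1 := by
      rw [← cpow_add _ _ ht']; simp
    rw [ofReal_mul, mul_cpow_ofReal_nonneg hx.le ht.le]
    linear_combination (-(x : ℂ) ^ (s - 1) * f (x * t)) * this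
  have hpow : ∀ t : ℝ, 0 < t → (t : ℂ) ^ (1 - s) * ((t⁻¹ : ℝ) : ℂ) = (t : ℂ) ^ (1 - s - 1) := by
    intro t ht
    rw [cpow_sub (1 - s) 1 (by exact_mod_cast ht.ne' : (t : ℂ) ≠ 0), cpow_one, ofReal_inv,
      div_eq_mul_inv]
  have hH : ∀ x t : ℝ, 0 < x → 0 < t → H x t = ((t : ℂ) ^ (1 - s) * g t) *
      (((x * t : ℝ) : ℂ) ^ (s - 1) * f (x * t)) := by
    intro x t hx ht
    linear_combination g t * hscale x t hx ht
  have hint : ∀ t : ℝ, 0 < t →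
      ∫ x in Set.Ioi (0 : ℝ), H x t = m * ((t : ℂ) ^ (1 - s - 1) * g t) := by
    intro t ht
    rw [setIntegral_congr_fun measurableSet_Ioi (fun x hx => hH x t hx ht), integral_const_mul,
      integral_comp_mul_right_Ioi (fun y : ℝ => (y : ℂ) ^ (s - 1) * f y) 0 ht, zero_mul,
      ← hpow t ht, ← hfs.2]
    simp only [mellin, smul_eq_mul, real_smul]
    ring
  have hnorm : ∀ t : ℝ, 0 < t → ∫ x in Set.Ioi (0 : ℝ), ‖H x t‖ =
      (∫ x in Set.Ioi (0 : ℝ), ‖(x : ℂ) ^ (s - 1) * f x‖) * ‖(t : ℂ) ^ (1 - s - 1) * g t‖ := by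
    intro t ht
    have e : Set.EqOn (fun x => ‖H x t‖) (fun x => ‖(t : ℂ) ^ (1 - s) * g t‖ *
      ‖((x * t : ℝ) : ℂ) ^ (s - 1) * f (x * t)‖) (Set.Ioi 0) := fun x hx => by
        simp only [hH x t hx ht, norm_mul]
    rw [setIntegral_congr_fun measurableSet_Ioi e, integral_const_mul,
      integral_comp_mul_right_Ioi (fun y : ℝ => ‖(y : ℂ) ^ (s - 1) * f y‖) 0 ht, zero_mul,
      ← hpow t ht]
    simp only [norm_mul, smul_eq_mul, norm_real, Real.norm_eq_abs, abs_of_pos (inv_pos.2 ht)]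
    ring
  have hInt : Integrable (Function.uncurry H)
      ((volume.restrict (Set.Ioi 0)).prod (volume.restrict (Set.Ioi 0))) := by
    refine (integrable_prod_iff' hmeas.aestronglyMeasurable).2 ⟨?_, ?_⟩
    · refine (ae_restrict_iff' measurableSet_Ioi).2 (Filter.Eventually.of_forall fun t ht => ?_)
      have h1 : IntegrableOn (fun x : ℝ => (((x * t : ℝ) : ℂ) ^ (s - 1) * f (x * t)))
          (Set.Ioi 0) :=
        (integrableOn_Ioi_comp_mul_right_iff (fun y : ℝ => (y : ℂ) ^ (s - 1) * f y) 0 ht).2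
          (by simpa [MellinConvergent] using hfs.1)
      exact IntegrableOn.congr_fun (h1.const_mul ((t : ℂ) ^ (1 - s) * g t))
        (fun x hx => (hH x t hx ht).symm) measurableSet_Ioi
    · exact IntegrableOn.congr_fun (Integrable.const_mul (Integrable.norm hgs.1) _)
        (fun t ht => (hnorm t ht).symm) measurableSet_Ioi
  have e : ∀ x : ℝ, ∫ t in Set.Ioi (0 : ℝ), H x t =
      (x : ℂ) ^ (s - 1) • ∫ t in Set.Ioi (0 : ℝ), f (x * t) * g t := fun x => by
    simp only [H, smul_eq_mul, integral_const_mul]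
  refine ⟨?_, ?_⟩
  · simpa only [Function.uncurry, e, MellinConvergent, IntegrableOn] using hInt.integral_prod_left
  · simp only [mellin, ← e]
    rw [integral_integral_swap hInt, setIntegral_congr_fun measurableSet_Ioi hint,
      integral_const_mul, ← hgs.2]
    rfl

theorem hasMellin_exp_neg {s : ℂ} (hs : 0 < s.re) :
    HasMellin (fun x : ℝ => (Real.exp (-x) : ℂ)) s (Complex.Gamma s) := by
  refine ⟨?_, ?_⟩
  · simpa only [MellinConvergent, smul_eq_mul, mul_comm] using Complex.GammaIntegral_convergent hs
  · rw [Complex.Gamma_eq_integral hs, Complex.GammaIntegral_eq_mellin]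

theorem hasMellin_exp_neg_inv {s : ℂ} (hs : s.re < 1) :
    HasMellin (fun x : ℝ => (Real.exp (-x⁻¹) : ℂ) * (x : ℂ)⁻¹) s (Complex.Gamma (1 - s)) := by
  have h0 := hasMellin_exp_neg (s := 1 - s) (by simpa using hs)
  have h1 : HasMellin (fun x : ℝ => (Real.exp (-x⁻¹) : ℂ)) (s + -1) (Complex.Gamma (1 - s)) := by
    refine ⟨?_, ?_⟩
    · have := (MellinConvergent.comp_rpow (f := fun x : ℝ => (Real.exp (-x) : ℂ))
        (s := s + -1) (a := -1) (by norm_num)).2 (by convert h0.1 using 1; push_cast; ring)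
      simpa only [Real.rpow_neg_one] using this
    · rw [mellin_comp_inv (fun x : ℝ => (Real.exp (-x) : ℂ)), ← h0.2]
      congr 1
      ring
  refine HasMellin.congr_Ioi (f := fun x : ℝ => (x : ℂ) ^ (-1 : ℂ) • (Real.exp (-x⁻¹) : ℂ))
    ⟨MellinConvergent.cpow_smul.2 h1.1, by rw [mellin_cpow_smul, h1.2]⟩ fun x _ => ?_
  rw [cpow_neg_one, smul_eq_mul, mul_comm]

/-- `∫ e^{-xt - 1/t} dt / t`, which is `2 K₀(2√x)` for `x > 0`. -/
noncomputable def besselKernel (x : ℝ) : ℂ :=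
  ∫ t in Set.Ioi (0 : ℝ), (Real.exp (-(x * t)) : ℂ) * ((Real.exp (-t⁻¹) : ℂ) * (t : ℂ)⁻¹)

theorem measurable_besselKernel : Measurable besselKernel := by
  refine (StronglyMeasurable.integral_prod_right
    (f := fun x t : ℝ => (Real.exp (-(x * t)) : ℂ) * ((Real.exp (-t⁻¹) : ℂ) * (t : ℂ)⁻¹))
    (Measurable.stronglyMeasurable ?_)).measurable
  unfold Function.uncurry
  fun_prop

theorem hasMellin_besselKernel {s : ℂ} (hs : 0 < s.re) :
    HasMellin besselKernel s (Complex.Gamma s * Complex.Gamma s) := by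
  have h := HasMellin.mulConvolution (by fun_prop) (by fun_prop) (hasMellin_exp_neg hs)
    (hasMellin_exp_neg_inv (s := 1 - s) (by simpa using hs))
  rwa [sub_sub_cancel] at h

theorem besselKernel_eq {x : ℝ} (hx : 0 < x) :
    besselKernel x = 2 * (besselK0 (2 * √x) : ℂ) := by
  have hq : 0 < √x := Real.sqrt_pos.2 hx
  have h1 : besselKernel x =
      mellin (fun t : ℝ => (Real.exp (-(x * t)) : ℂ) * (Real.exp (-t⁻¹) : ℂ)) 0 := by
    refine setIntegral_congr_fun measurableSet_Ioi fun t _ => ?_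
    simp only [zero_sub, cpow_neg_one, smul_eq_mul]
    ring
  have h2 := mellin_comp_mul_left
    (fun t : ℝ => (Real.exp (-(√x * t)) : ℂ) * (Real.exp (-(√x * t⁻¹)) : ℂ)) 0 hq
  have h3 : (fun t : ℝ => (Real.exp (-(√x * (√x * t))) : ℂ) *
      (Real.exp (-(√x * (√x * t)⁻¹)) : ℂ)) =
      fun t : ℝ => (Real.exp (-(x * t)) : ℂ) * (Real.exp (-t⁻¹) : ℂ) := by
    funext t
    rw [← mul_assoc, Real.mul_self_sqrt hx.le, mul_inv, mul_inv_cancel_left₀ hq.ne']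
  rw [h3] at h2
  rw [h1, h2, mellin_eq_fourier]
  simp only [neg_zero, cpow_zero, one_smul, zero_re, zero_im, zero_div, zero_mul, Real.exp_zero,
    Real.fourier_real_eq_integral_exp_smul, mul_zero, ofReal_zero, Complex.exp_zero]
  rw [besselK0]
  have h4 := integral_comp_abs (f := fun t => Real.exp (-(2 * √x) * Real.cosh t))
  simp only [Real.cosh_abs] at h4
  have h5 : (2 : ℂ) * ((∫ t in Set.Ioi (0 : ℝ), Real.exp (-(2 * √x) * Real.cosh t) : ℝ) : ℂ)
     = ((∫ t : ℝ, Real.exp (-(2 * √x) * Real.cosh t) : ℝ) : ℂ) := by rw [h4]; push_cast; rfl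
  rw [h5, ← integral_complex_ofReal]
  refine integral_congr_ae (Filter.Eventually.of_forall fun u => ?_)
  simp only [← ofReal_mul, ← Real.exp_add, Real.exp_neg u, inv_inv, Real.cosh_eq]
  congr 2
  ring

theorem hasMellin_one_div_one_add {s : ℂ} (h0 : 0 < s.re) (h1 : s.re < 1) :
    HasMellin (fun x : ℝ => ((1 / (1 + x) : ℝ) : ℂ)) s
      (Complex.Gamma s * Complex.Gamma (1 - s)) := by
  refine (HasMellin.mulConvolution (by fun_prop) (by fun_prop) (hasMellin_exp_neg h0)
    (hasMellin_exp_neg (s := 1 - s) (by simpa using h1))).congr_Ioi fun x hx => ?_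
  have := integral_exp_mul_Ioi (a := -(1 + x)) (by linarith) 0
  simp only [← ofReal_mul, ← Real.exp_add]
  rw [integral_complex_ofReal]
  congr 1
  rw [mul_zero, Real.exp_zero, neg_div_neg_eq] at this
  rw [← this]
  refine integral_congr_ae (Filter.Eventually.of_forall fun u => ?_)
  simp only
  ring_nf

theorem hasMellin_log_one_add {s : ℂ} (h0 : -1 < s.re) (h1 : s.re < 0) :
    HasMellin (fun x : ℝ => (Real.log (1 + x) : ℂ)) s
      (Complex.Gamma (1 + s) * Complex.Gamma (-s) * (1 / -s)) := by
  have hI := hasMellin_one_Ioc (s := -s) (by simpa using h1)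
  have hL := hasMellin_one_div_one_add (s := s + 1) (by simp; linarith) (by simpa using h1)
  have h := HasMellin.mulConvolution (by fun_prop)
    ((measurable_const (a := (1 : ℂ))).indicator (measurableSet_Ioc (a := (0 : ℝ)) (b := 1))) hL
    (by rwa [show 1 - (s + 1) = -s by ring])
  rw [show 1 - (s + 1) = -s by ring, add_comm s 1, add_comm 1 s] at h
  refine HasMellin.congr_Ioi ⟨MellinConvergent.cpow_smul.2 h.1,
    (mellin_cpow_smul _ s 1).trans (by rw [h.2, add_comm])⟩ fun x hx => ?_
  have hF : ∫ t in (0 : ℝ)..1, 1 / (1 + x * t) = Real.log (1 + x) / x := by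
    rw [intervalIntegral.integral_eq_sub_of_hasDerivAt (f := fun t => Real.log (1 + x * t) / x)]
    · simp
    · intro t ht
      rw [Set.uIcc_of_le zero_le_one] at ht
      have hpos : 0 < 1 + x * t := by nlinarith [mul_nonneg hx.le ht.1]
      have := ((((hasDerivAt_id t).const_mul x).const_add 1).log hpos.ne').div_const x
      have e : x * 1 / (1 + x * t) / x = 1 / (1 + x * t) := by
        rw [mul_one, div_div, mul_comm (1 + x * t) x, ← div_div, div_self hx.ne']
      exact e ▸ this
    · refine ContinuousOn.intervalIntegrable fun t ht => ContinuousAt.continuousWithinAt ?_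
      rw [Set.uIcc_of_le zero_le_one] at ht
      have hpos : 0 < 1 + x * t := by nlinarith [mul_nonneg hx.le ht.1]
      exact ContinuousAt.div (by fun_prop) (by fun_prop) hpos.ne'
  have hG : ∫ t in Set.Ioi (0 : ℝ), ((1 / (1 + x * t) : ℝ) : ℂ) *
      (Set.Ioc (0 : ℝ) 1).indicator (fun _ => (1 : ℂ)) t = ((Real.log (1 + x) / x : ℝ) : ℂ) := by
    rw [← hF, intervalIntegral.integral_of_le zero_le_one, ← integral_complex_ofReal]
    have : (fun t : ℝ => ((1 / (1 + x * t) : ℝ) : ℂ) *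
        (Set.Ioc (0 : ℝ) 1).indicator (fun _ => (1 : ℂ)) t) =
        (Set.Ioc (0 : ℝ) 1).indicator fun t => ((1 / (1 + x * t) : ℝ) : ℂ) := by
      funext t
      by_cases ht : t ∈ Set.Ioc (0 : ℝ) 1 <;> simp [ht]
    rw [this, setIntegral_indicator measurableSet_Ioc, Set.inter_eq_right.2 Set.Ioc_subset_Ioi_self]
  rw [hG, cpow_one, smul_eq_mul, ← ofReal_mul, mul_div_cancel₀ _ hx.ne']

theorem log_one_add_le_two_mul_sqrt {x : ℝ} (hx : 0 ≤ x) : Real.log (1 + x) ≤ 2 * √x := by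
  have h : 1 + x ≤ (1 + √x) ^ 2 := by nlinarith [Real.sq_sqrt hx, Real.sqrt_nonneg x]
  calc Real.log (1 + x) ≤ Real.log ((1 + √x) ^ 2) := Real.log_le_log (by linarith) h
    _ = 2 * Real.log (1 + √x) := by rw [Real.log_pow]; norm_num
    _ ≤ 2 * √x := by
      have := Real.log_le_sub_one_of_pos (x := 1 + √x) (by positivity)
      linarith

/-- Up to scaling, the ergodic capacity as a function of the Meijer G-function's argument. -/
noncomputable def capacityKernel (x : ℝ) : ℂ :=
  ∫ a in Set.Ioi (0 : ℝ), besselKernel (x * a) * (Real.log (1 + a) : ℂ)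

theorem hasMellin_capacityKernel {s : ℂ} (h1 : 1 < s.re) (h2 : s.re < 2) :
    HasMellin capacityKernel s (Complex.Gamma (-1 + s) * Complex.Gamma (-1 + s) *
      Complex.Gamma s * Complex.Gamma (2 - s)) := by
  have h := HasMellin.mulConvolution measurable_besselKernel (by fun_prop)
    (hasMellin_besselKernel (s := s) (by linarith))
    (hasMellin_log_one_add (s := 1 - s) (by simp; linarith) (by simpa using h1))
  have hs : s - 1 ≠ 0 := fun h0 => by
    have := congrArg Complex.re h0
    simp at this
    linarith
  have hG := Complex.Gamma_add_one (s - 1) hs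
  rw [sub_add_cancel] at hG
  refine (congrArg (HasMellin capacityKernel s) ?_).mpr h
  rw [show -1 + s = s - 1 by ring, show 1 + (1 - s) = 2 - s by ring, neg_sub, hG]
  field_simp

theorem norm_Gamma_le_Gamma_re {s : ℂ} (hs : 0 < s.re) :
    ‖Complex.Gamma s‖ ≤ Real.Gamma s.re := by
  rw [Complex.Gamma_eq_integral hs, Real.Gamma_eq_integral hs, Complex.GammaIntegral]
  refine (norm_integral_le_integral_norm _).trans (le_of_eq ?_)
  refine setIntegral_congr_fun measurableSet_Ioi fun x hx => ?_
  simp only [norm_mul, norm_real, Real.norm_eq_abs, Real.abs_exp, norm_cpow_eq_rpow_re_of_pos hx,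
    sub_re, one_re]

theorem one_add_sq_div_two_le_cosh (x : ℝ) : 1 + x ^ 2 / 2 ≤ Real.cosh x := by
  have h : x ^ 2 / 4 ≤ Real.sinh (x / 2) ^ 2 := by
    have : |x / 2| ≤ |Real.sinh (x / 2)| := by
      rw [Real.abs_sinh]
      exact Real.self_le_sinh_iff.2 (abs_nonneg _)
    have := sq_le_sq.2 this
    linarith
  have h2 := Real.cosh_two_mul (x / 2)
  rw [mul_div_cancel₀ x two_ne_zero] at h2
  have h3 := Real.cosh_sq (x / 2)
  linarith

theorem norm_Gamma_half_mul_Gamma_half_le (t : ℝ) :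
    ‖Complex.Gamma (1 / 2 + t * I) * Complex.Gamma (1 / 2 - t * I)‖ ≤ π * (1 + t ^ 2)⁻¹ := by
  have h := Complex.Gamma_mul_Gamma_one_sub (1 / 2 + t * I)
  have e : Complex.sin (π * (1 / 2 + t * I)) = (Real.cosh (π * t) : ℂ) := by
    rw [show (π : ℂ) * (1 / 2 + t * I) = (π * t : ℂ) * I + π / 2 by ring,
      Complex.sin_add_pi_div_two, Complex.cos_mul_I]
    push_cast
    rfl
  rw [show (1 : ℂ) - (1 / 2 + t * I) = 1 / 2 - t * I by ring, e] at h
  rw [h, norm_div, norm_real, norm_real, Real.norm_eq_abs, Real.norm_eq_abs, abs_of_pos pi_pos,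
    abs_of_pos (Real.cosh_pos _), div_eq_mul_inv]
  have h1 := one_add_sq_div_two_le_cosh (π * t)
  have h2 : 1 + t ^ 2 ≤ Real.cosh (π * t) := by
    nlinarith [pi_gt_three, mul_nonneg (sq_nonneg t) (by nlinarith [pi_gt_three] : 0 ≤ π ^ 2 - 2)]
  gcongr

theorem verticalIntegrable_mellin_capacityKernel :
    VerticalIntegrable (mellin capacityKernel) (3 / 2) := by
  have hre : ∀ t : ℝ, (((3 / 2 : ℝ) : ℂ) + t * I).re = 3 / 2 := fun t => by simp
  have hm : ∀ t : ℝ, mellin capacityKernel (((3 / 2 : ℝ) : ℂ) + t * I) =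
      Complex.Gamma (1 / 2 + t * I) * Complex.Gamma (3 / 2 + t * I) *
        (Complex.Gamma (1 / 2 + t * I) * Complex.Gamma (1 / 2 - t * I)) := fun t => by
    rw [(hasMellin_capacityKernel (by rw [hre]; norm_num) (by rw [hre]; norm_num)).2]
    push_cast
    rw [show (-1 : ℂ) + (3 / 2 + t * I) = 1 / 2 + t * I by ring,
      show (2 : ℂ) - (3 / 2 + t * I) = 1 / 2 - t * I by ring]
    ring
  have hc : ∀ (r : ℝ) (ε : ℝ), 0 < r → Continuous fun t : ℝ => Complex.Gamma (r + ε * (t * I)) := by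
    intro r ε hr
    refine continuous_iff_continuousAt.2 fun t => ?_
    refine ContinuousAt.comp (f := fun t : ℝ => (r + ε * (t * I) : ℂ)) (g := Complex.Gamma)
      (DifferentiableAt.continuousAt (Complex.differentiableAt_Gamma _ fun m hm => ?_)) (by fun_prop)
    have h := congrArg Complex.re hm
    simp at h
    have : (0 : ℝ) ≤ m := Nat.cast_nonneg m
    linarith
  have c1 : Continuous fun t : ℝ => Complex.Gamma (1 / 2 + t * I) := by
    simpa using hc (1 / 2) 1 (by norm_num)
  have c2 : Continuous fun t : ℝ => Complex.Gamma (3 / 2 + t * I) := by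
    simpa using hc (3 / 2) 1 (by norm_num)
  have c3 : Continuous fun t : ℝ => Complex.Gamma (1 / 2 - t * I) := by
    simpa [sub_eq_add_neg] using hc (1 / 2) (-1) (by norm_num)
  simp only [VerticalIntegrable, hm]
  refine Integrable.mono' (g := fun t : ℝ => Real.Gamma (1 / 2) * Real.Gamma (3 / 2) *
      (π * (1 + t ^ 2)⁻¹)) ((integrable_inv_one_add_sq.const_mul _).const_mul _)
    ((c1.mul c2).mul (c1.mul c3)).aestronglyMeasurable (Filter.Eventually.of_forall fun t => ?_)
  have b1 : ‖Complex.Gamma (1 / 2 + t * I)‖ ≤ Real.Gamma (1 / 2) := by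
    simpa using norm_Gamma_le_Gamma_re (s := 1 / 2 + t * I) (by simp)
  have b2 : ‖Complex.Gamma (3 / 2 + t * I)‖ ≤ Real.Gamma (3 / 2) := by
    simpa using norm_Gamma_le_Gamma_re (s := 3 / 2 + t * I) (by simp)
  have p1 : 0 ≤ Real.Gamma (1 / 2) := (Real.Gamma_pos_of_pos (by norm_num)).le
  have p2 : 0 ≤ Real.Gamma (3 / 2) := (Real.Gamma_pos_of_pos (by norm_num)).le
  rw [norm_mul, norm_mul]
  exact mul_le_mul (mul_le_mul b1 b2 (norm_nonneg _) p1) (norm_Gamma_half_mul_Gamma_half_le t)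
    (norm_nonneg _) (mul_nonneg p1 p2)

theorem continuousAt_capacityKernel {x : ℝ} (hx : 0 < x) : ContinuousAt capacityKernel x := by
  have hpos : ∀ᶠ y in nhds x, x / 2 < y := lt_mem_nhds (by linarith)
  have hscale : ∀ᶠ y in nhds x, capacityKernel y =
      (y : ℂ)⁻¹ * ∫ t in Set.Ioi (0 : ℝ), besselKernel t * (Real.log (1 + t / y) : ℂ) := by
    filter_upwards [hpos] with y hy
    have hy0 : 0 < y := by linarith
    have := integral_comp_mul_left_Ioi
      (fun t : ℝ => besselKernel t * (Real.log (1 + t / y) : ℂ)) 0 hy0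
    simp only [mul_zero, mul_div_cancel_left₀ _ hy0.ne', real_smul, ofReal_inv] at this
    exact this
  refine ContinuousAt.congr ?_ (hscale.mono fun _ h => h.symm)
  refine ContinuousAt.mul (ContinuousAt.inv₀ (by fun_prop) (by exact_mod_cast hx.ne')) ?_
  have hK : IntegrableOn (fun t : ℝ => (t : ℂ) ^ ((3 / 2 : ℂ) - 1) • besselKernel t)
      (Set.Ioi 0) := (hasMellin_besselKernel (s := 3 / 2) (by norm_num)).1
  refine continuousAt_of_dominated (bound := fun t => 2 * √(2 / x) *
      ‖(t : ℂ) ^ ((3 / 2 : ℂ) - 1) • besselKernel t‖) ?_ ?_ (hK.norm.const_mul _) ?_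
  · refine Filter.Eventually.of_forall fun y => (Measurable.aestronglyMeasurable ?_)
    exact measurable_besselKernel.mul (by fun_prop)
  · filter_upwards [hpos] with y hy
    refine (ae_restrict_iff' measurableSet_Ioi).2 (Filter.Eventually.of_forall fun t ht => ?_)
    have ht : 0 < t := ht
    have hy0 : 0 < y := by linarith
    have hlog : Real.log (1 + t / y) ≤ 2 * √(2 / x) * √t := by
      refine (log_one_add_le_two_mul_sqrt (by positivity)).trans ?_
      rw [mul_assoc, ← Real.sqrt_mul (by positivity)]
      have : t / y ≤ 2 / x * t := by
        rw [div_mul_eq_mul_div, div_le_div_iff₀ hy0 hx]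
        nlinarith
      gcongr
    have hlog0 : 0 ≤ Real.log (1 + t / y) :=
      Real.log_nonneg (le_add_of_nonneg_right (by positivity))
    rw [norm_mul, norm_smul, norm_cpow_eq_rpow_re_of_pos ht, norm_real, Real.norm_eq_abs,
      abs_of_nonneg hlog0, show ((3 / 2 : ℂ) - 1).re = 1 / 2 by norm_num, ← Real.sqrt_eq_rpow]
    calc ‖besselKernel t‖ * Real.log (1 + t / y) ≤ ‖besselKernel t‖ * (2 * √(2 / x) * √t) := by
          gcongr
      _ = _ := by ring
  · refine (ae_restrict_iff' measurableSet_Ioi).2 (Filter.Eventually.of_forall fun t ht => ?_)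
    have ht : 0 < t := ht
    refine ContinuousAt.mul continuousAt_const (continuous_ofReal.continuousAt.comp ?_)
    refine ContinuousAt.log (continuousAt_const.add (continuousAt_const.div continuousAt_id hx.ne'))
      ?_
    have : 0 < t / x := by positivity
    exact (by linarith : 0 < 1 + t / x).ne'

theorem capacityKernel_eq_meijerG3113 {z : ℝ} (hz : 0 < z) :
    capacityKernel z = meijerG3113 z := by
  have hre : ∀ t : ℝ, ((3 / 2 : ℂ) + t * I).re = 3 / 2 := fun t => by simp
  have hconv : MellinConvergent capacityKernel ((3 / 2 : ℝ) : ℂ) :=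
    (hasMellin_capacityKernel (by norm_num [-ofReal_div]) (by norm_num [-ofReal_div])).1
  rw [← mellinInv_mellin_eq (3 / 2) capacityKernel hz hconv
    verticalIntegrable_mellin_capacityKernel (continuousAt_capacityKernel hz), mellinInv,
    meijerG3113, integral_mul_const, real_smul]
  have hI : ∀ J : ℂ, ((1 / (2 * π) : ℝ) : ℂ) * J = 1 / (2 * π * I) * (J * I) := fun J => by
    push_cast
    have := I_ne_zero
    have : (π : ℂ) ≠ 0 := by exact_mod_cast pi_ne_zero
    field_simp
  rw [hI]
  congr 3
  funext t
  push_cast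
  rw [(hasMellin_capacityKernel (by rw [hre]; norm_num) (by rw [hre]; norm_num)).2, smul_eq_mul,
    mul_comm]

/-- Ergodic capacity of the double-Rayleigh fading channel (bandwidth `B = 1`):
`∫_0^∞ ln(1+a)·(1/(cσ²))·K₀(√(2a/(cσ²))) da = (1/(2cσ²))·G^{3,1}_{1,3}(1/(2cσ²) | −1; −1,−1,0)`. -/
theorem capacity_double_rayleigh_meijerG (c σ : ℝ) (hc : 0 < c) (hσ : 0 < σ) :
    ((∫ a in Set.Ioi (0 : ℝ),
        Real.log (1 + a) * ((1 / (c * σ ^ 2)) *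
          besselK0 (Real.sqrt (2 * a / (c * σ ^ 2))))) : ℂ) =
      (1 / (2 * (c : ℂ) * (σ : ℂ) ^ 2)) * meijerG3113 (1 / (2 * c * σ ^ 2)) := by
  rw [← capacityKernel_eq_meijerG3113 (by positivity), capacityKernel, ← integral_const_mul]
  refine setIntegral_congr_fun measurableSet_Ioi fun a ha => ?_
  have ha : 0 < a := ha
  have h4 : √(2 * a / (c * σ ^ 2)) = 2 * √(1 / (2 * c * σ ^ 2) * a) := by
    rw [show 2 * a / (c * σ ^ 2) = 2 ^ 2 * (1 / (2 * c * σ ^ 2) * a) by field_simp,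
      Real.sqrt_mul (by norm_num), Real.sqrt_sq (by norm_num)]
  rw [besselKernel_eq (by positivity), h4]
  have h1 : (c : ℂ) ≠ 0 := by exact_mod_cast hc.ne'
  have h2 : (σ : ℂ) ≠ 0 := by exact_mod_cast hσ.ne'
  field_simp
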